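/- Let G be a connected graph and let (u,v) be a dominating pair of G with dist(u,v) = e(v). Then every vertex w with eccentricity e(w) ≥ 3 is at distance exactly e(w) from some vertex z satisfying dist(v,z) ≤ 1 or dist(v,z) ≥ e(v) − 1. -/

import Mathlib

open SimpleGraph

/-- The closed neighbourhood `N[x]` of a vertex `x`. -/
def closedNbhd {V : Type*} (G : SimpleGraph V) (x : V) : Set V :=
  {z | z = x ∨ G.Adj x z}

/-- `(u,v)` is a dominating pair of `G`: every path between `u` and `v`
contains a vertex of `N[x]`, for every vertex `x`. -/
def DominatingPair {V : Type*} (G : SimpleGraph V) (u v : V) : Prop :=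
  ∀ (x : V) (p : G.Walk u v), p.IsPath → ∃ z ∈ p.support, z ∈ closedNbhd G x

/-- The eccentricity of a vertex: the maximum distance to any other vertex. -/
noncomputable def ecc {V : Type*} [Fintype V] (G : SimpleGraph V) (u : V) : ℕ :=
  Finset.univ.sup fun v => G.dist u v

theorem aux_end {V : Type*} (G : SimpleGraph V) {w a y : V} (p : G.Walk w a)
    (hy : y ∈ p.support) (h : p.length ≤ G.dist w y) : y = a := by
  classical
  have h1 := G.dist_le (p.takeUntil y hy)
  have h2 : (p.takeUntil y hy).length + (p.dropUntil y hy).length = p.length := by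
    rw [← Walk.length_append, Walk.take_spec]
  exact Walk.eq_of_length_eq_zero (p := p.dropUntil y hy) (by omega)

theorem aux_le_ecc {V : Type*} [Fintype V] (G : SimpleGraph V) (a b : V) :
    G.dist a b ≤ ecc G a :=
  Finset.le_sup (f := fun v => G.dist a v) (Finset.mem_univ b)

/-- If `(u,v)` is a dominating pair of a connected graph `G` with `dist(u,v) = e(v)`,
then every vertex `w` with eccentricity at least `3` is at distance exactly `e(w)` from
some vertex `z` with `dist(v,z) ≤ 1` or `dist(v,z) ≥ e(v) - 1`. -/
theorem dominating_pair_far_vertex_layers {V : Type*} [Fintype V] (G : SimpleGraph V)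
    (hconn : G.Connected) (u v : V) (hdom : DominatingPair G u v)
    (huv : G.dist u v = ecc G v) (w : V) (hw : 3 ≤ ecc G w) :
    ∃ z : V, (G.dist v z ≤ 1 ∨ ecc G v - 1 ≤ G.dist v z) ∧ G.dist w z = ecc G w := by
  classical
  by_cases hu : G.dist w u = ecc G w
  · exact ⟨u, Or.inr (by rw [G.dist_comm, huv]; omega), hu⟩
  by_cases hv : G.dist w v = ecc G w
  · exact ⟨v, Or.inl (by simp), hv⟩
  have hu' := aux_le_ecc G w u
  have hv' := aux_le_ecc G w v
  obtain ⟨z, -, hz⟩ := Finset.exists_mem_eq_sup Finset.univ ⟨w, Finset.mem_univ w⟩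
    (fun x => G.dist w x)
  have hz' : G.dist w z = ecc G w := hz.symm
  refine ⟨z, ?_, hz'⟩
  obtain ⟨p, hp⟩ := hconn.exists_walk_length_eq_dist w u
  obtain ⟨q, hq⟩ := hconn.exists_walk_length_eq_dist w v
  obtain ⟨y, hy, hyz⟩ := hdom z (p.reverse.append q).bypass (Walk.bypass_isPath _)
  have hy1 := Walk.support_bypass_subset _ hy
  have hd : G.dist y z ≤ 1 := by
    rcases hyz with rfl | h
    · simp
    · rw [dist_eq_one_iff_adj.2 h.symm]
  have ht := hconn.dist_triangle (u := w) (v := y) (w := z)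
  rw [Walk.mem_support_append_iff, Walk.support_reverse, List.mem_reverse] at hy1
  rcases hy1 with h | h
  · have := aux_end G p h (by omega)
    subst this
    right
    have h3 := hconn.dist_triangle (u := v) (v := z) (w := y)
    rw [G.dist_comm (u := z), G.dist_comm (u := v) (v := y)] at h3
    omega
  · have := aux_end G q h (by omega)
    subst this
    exact Or.inl hd
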